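/- Let a, b, c, d be real with t = a+b+c+d, let n ≥ k ≥ 0 be integers, and let (x,y) be real with x ≠ 1; write u(x,y) = P_{n,k}^{(a,b,c,d)}(x,y). Then: (n+k+t+2 + xk/(1−x))·u + x·∂u/∂x − (xy/(1−x))·∂u/∂y = (n+k+t+2)·P_{n,k}^{(a,b,c,d+1)}(x,y); (n+k+b+c+d+1 − xn)·u − x(1−x)·∂u/∂x + xy·∂u/∂y = (n+k+t−a+1)·P_{n,k}^{(a,b,c,d−1)}(x,y); (n+a+b+c+d+2)·u − (1−x)·∂u/∂x + y·∂u/∂y = (n+k+t+2)·P_{n,k}^{(a+1,b,c,d)}(x,y); and (a+xn)·u + x(1−x)·∂u/∂x − xy·∂u/∂y = (n−k+a)·P_{n,k}^{(a−1,b,c,d)}(x,y). -/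

import Mathlib

noncomputable section

/-- Generalized binomial coefficient `C(α, j) = α(α−1)⋯(α−j+1)/j!`. -/
def genBinom (α : ℝ) (j : ℕ) : ℝ :=
  (∏ i ∈ Finset.range j, (α - i)) / (Nat.factorial j)

/-- Jacobi polynomial `P_n^{(a,b)}(x)`; zero for negative `n`. -/
def jacobiP (n : ℤ) (a b : ℝ) (x : ℝ) : ℝ :=
  if n < 0 then 0 else
    ∑ m ∈ Finset.range (n.toNat + 1),
      genBinom ((n : ℝ) + a) (n.toNat - m) * genBinom ((n : ℝ) + b) m *
        ((x - 1) / 2) ^ m * ((x + 1) / 2) ^ (n.toNat - m)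

/-- Four-parameter Koornwinder polynomial `P_{n,k}^{(a,b,c,d)}(x,y)`;
zero whenever `k < 0`, `n < 0`, or `k > n` (covering the conventions
`k = −1`, `n = −1`, `k = n+1`). -/
def koornP (n k : ℤ) (a b c d : ℝ) (x y : ℝ) : ℝ :=
  if n < 0 ∨ k < 0 ∨ n < k then 0 else
    jacobiP (n - k) (2 * (k : ℝ) + b + c + d + 1) a (2 * x - 1) *
      (1 - x) ^ k.toNat * jacobiP k c b (-1 + 2 * y / (1 - x))

/-- The homogeneous form `∑_{i+j=N} C(p,i) C(q,j) u^i v^j` underlying the Jacobi polynomials. -/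
def jacobiForm (N : ℕ) (p q u v : ℝ) : ℝ :=
  ∑ ij ∈ Finset.HasAntidiagonal.antidiagonal N,
    genBinom p ij.1 * genBinom q ij.2 * u ^ ij.1 * v ^ ij.2

/-- The partial derivative of `jacobiForm` in its first variable. -/
def jacobiFormDeriv (N : ℕ) (p q u v : ℝ) : ℝ :=
  ∑ ij ∈ Finset.HasAntidiagonal.antidiagonal N,
    genBinom p ij.1 * genBinom q ij.2 * (ij.1 * u ^ (ij.1 - 1)) * v ^ ij.2

theorem succ_mul_genBinom_succ (p : ℝ) (i : ℕ) :
    ((i : ℝ) + 1) * genBinom p (i + 1) = (p - i) * genBinom p i := by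
  have h1 : (Nat.factorial i : ℝ) ≠ 0 := by positivity
  have h2 : (i : ℝ) + 1 ≠ 0 := by positivity
  rw [genBinom, genBinom, Finset.prod_range_succ, Nat.factorial_succ]
  push_cast
  field_simp

theorem sub_mul_genBinom (p : ℝ) (i : ℕ) :
    (p - i) * genBinom p i = p * genBinom (p - 1) i := by
  have h : (∏ j ∈ Finset.range i, (p - j)) * (p - i)
      = (∏ j ∈ Finset.range i, (p - 1 - j)) * p := by
    rw [← Finset.prod_range_succ, Finset.prod_range_succ']
    simp [sub_sub, add_comm]
  rw [genBinom, genBinom, mul_div_assoc', mul_div_assoc', mul_comm, h, mul_comm]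

theorem genBinom_add_one_succ (p : ℝ) (i : ℕ) :
    genBinom (p + 1) (i + 1) = genBinom p (i + 1) + genBinom p i := by
  have h1 : ((i : ℝ) + 1) ≠ 0 := by positivity
  have h2 := succ_mul_genBinom_succ p i
  have h3 := succ_mul_genBinom_succ (p + 1) i
  have h4 := sub_mul_genBinom (p + 1) i
  rw [add_sub_cancel_right] at h4
  apply mul_left_cancel₀ h1
  linear_combination h3 - h2 + h4

@[simp]
theorem genBinom_zero (p : ℝ) : genBinom p 0 = 1 := by
  simp [genBinom]

theorem jacobiForm_swap (N : ℕ) (p q u v : ℝ) :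
    jacobiForm N p q u v = jacobiForm N q p v u := by
  rw [jacobiForm, jacobiForm, ← Finset.Nat.sum_antidiagonal_swap]
  refine Finset.sum_congr rfl fun ij _ => ?_
  simp only [Prod.fst_swap, Prod.snd_swap]
  ring

theorem jacobiFormDeriv_euler (N : ℕ) (p q u v : ℝ) :
    u * jacobiFormDeriv N p q u v + v * jacobiFormDeriv N q p v u
      = N * jacobiForm N p q u v := by
  have hpow : ∀ (w : ℝ) (i : ℕ), w * (i * w ^ (i - 1)) = i * w ^ i := by
    rintro w (_ | i)
    · simp
    · rw [Nat.add_sub_cancel]; ring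
  rw [jacobiFormDeriv, jacobiFormDeriv, jacobiForm, ← Finset.Nat.sum_antidiagonal_swap (n := N)
    (f := fun ij => genBinom q ij.1 * genBinom p ij.2 * (ij.1 * v ^ (ij.1 - 1)) * u ^ ij.2),
    Finset.mul_sum, Finset.mul_sum, Finset.mul_sum, ← Finset.sum_add_distrib]
  refine Finset.sum_congr rfl fun ij h => ?_
  have hN : (N : ℝ) = ij.1 + ij.2 := by
    rw [← Finset.HasAntidiagonal.mem_antidiagonal.1 h]; push_cast; rfl
  simp only [Prod.fst_swap, Prod.snd_swap]
  rw [hN]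
  linear_combination genBinom p ij.1 * genBinom q ij.2 *
    (v ^ ij.2 * hpow u ij.1 + u ^ ij.1 * hpow v ij.2)

theorem jacobiForm_lower (N : ℕ) (p q u v : ℝ) :
    p * jacobiForm N p q u v - u * jacobiFormDeriv N p q u v
      = p * jacobiForm N (p - 1) q u v := by
  simp only [jacobiForm, jacobiFormDeriv, Finset.mul_sum]
  rw [← Finset.sum_sub_distrib]
  refine Finset.sum_congr rfl fun ij _ => ?_
  have h := sub_mul_genBinom p ij.1
  have hpow : u * (ij.1 * u ^ (ij.1 - 1)) = ij.1 * u ^ ij.1 := by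
    cases ij.1
    · simp
    · rw [Nat.add_sub_cancel]; ring
  linear_combination genBinom q ij.2 * u ^ ij.1 * v ^ ij.2 * h
    - genBinom p ij.1 * genBinom q ij.2 * v ^ ij.2 * hpow

theorem jacobiFormDeriv_succ (M : ℕ) (p q u v : ℝ) :
    jacobiFormDeriv (M + 1) p q u v
      = ∑ ij ∈ Finset.HasAntidiagonal.antidiagonal M,
          (p - ij.1) * genBinom p ij.1 * genBinom q ij.2 * u ^ ij.1 * v ^ ij.2 := by
  rw [jacobiFormDeriv, Finset.Nat.sum_antidiagonal_succ]
  simp only [Nat.cast_zero, zero_mul, mul_zero, zero_add, Nat.add_sub_cancel]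
  refine Finset.sum_congr rfl fun ij _ => ?_
  push_cast
  linear_combination genBinom q ij.2 * u ^ ij.1 * v ^ ij.2 * succ_mul_genBinom_succ p ij.1

theorem jacobiForm_raise (N : ℕ) (p q u v : ℝ) :
    (p + q - N + 1) * jacobiForm N p q u v
        + u * (jacobiFormDeriv N p q u v + jacobiFormDeriv N q p v u)
      = (p + q - N + 1) * jacobiForm N (p + 1) q u v := by
  cases N with
  | zero => simp [jacobiForm, jacobiFormDeriv]
  | succ M =>
    have hJ : jacobiForm (M + 1) (p + 1) q u v
        = jacobiForm (M + 1) p q u v + u * jacobiForm M p q u v := by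
      simp only [jacobiForm, Finset.Nat.sum_antidiagonal_succ, genBinom_add_one_succ,
        genBinom_zero, Finset.mul_sum]
      rw [add_assoc, ← Finset.sum_add_distrib]
      congr 1
      refine Finset.sum_congr rfl fun ij _ => ?_
      ring
    have hD : jacobiFormDeriv (M + 1) p q u v + jacobiFormDeriv (M + 1) q p v u
        = (p + q - M) * jacobiForm M p q u v := by
      rw [jacobiFormDeriv_succ, jacobiFormDeriv_succ, jacobiForm,
        ← Finset.Nat.sum_antidiagonal_swap (n := M) (f := fun ij =>
          (q - ij.1) * genBinom q ij.1 * genBinom p ij.2 * v ^ ij.1 * u ^ ij.2),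
        Finset.mul_sum, ← Finset.sum_add_distrib]
      refine Finset.sum_congr rfl fun ij h => ?_
      have hM : (M : ℝ) = ij.1 + ij.2 := by
        rw [← Finset.HasAntidiagonal.mem_antidiagonal.1 h]; push_cast; rfl
      simp only [Prod.fst_swap, Prod.snd_swap]
      rw [hM]
      ring
    rw [hJ, hD]
    push_cast
    ring

theorem HasDerivAt.jacobiForm (N : ℕ) (p q : ℝ) {f g : ℝ → ℝ} {f' g' x : ℝ}
    (hf : HasDerivAt f f' x) (hg : HasDerivAt g g' x) :
    HasDerivAt (fun t => jacobiForm N p q (f t) (g t))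
      (f' * jacobiFormDeriv N p q (f x) (g x) + g' * jacobiFormDeriv N q p (g x) (f x)) x := by
  have h : HasDerivAt (fun t => _root_.jacobiForm N p q (f t) (g t)) _ x :=
    HasDerivAt.fun_sum (u := Finset.HasAntidiagonal.antidiagonal N)
      (A := fun ij t => genBinom p ij.1 * genBinom q ij.2 * f t ^ ij.1 * g t ^ ij.2)
      fun ij _ => ((hf.fun_pow ij.1).const_mul (genBinom p ij.1 * genBinom q ij.2)).mul
        (hg.fun_pow ij.2)
  refine h.congr_deriv ?_
  rw [jacobiFormDeriv, jacobiFormDeriv, ← Finset.Nat.sum_antidiagonal_swap (n := N)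
    (f := fun ij =>
      genBinom q ij.1 * genBinom p ij.2 * (ij.1 * g x ^ (ij.1 - 1)) * f x ^ ij.2),
    Finset.mul_sum, Finset.mul_sum, ← Finset.sum_add_distrib]
  refine Finset.sum_congr rfl fun ij _ => ?_
  simp only [Prod.fst_swap, Prod.snd_swap]
  ring

theorem jacobiP_natCast (N : ℕ) (a b z : ℝ) :
    jacobiP N a b z = jacobiForm N (N + a) (N + b) ((z + 1) / 2) ((z - 1) / 2) := by
  rw [jacobiForm_swap, jacobiForm, Finset.Nat.sum_antidiagonal_eq_sum_range_succ_mk, jacobiP,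
    if_neg (by omega)]
  simp only [Int.toNat_natCast, Int.cast_natCast]
  refine Finset.sum_congr rfl fun m _ => ?_
  ring

theorem koornP_add_natCast (N k : ℕ) (a b c d x y : ℝ) :
    koornP ((k : ℤ) + N) k a b c d x y
      = jacobiForm N (N + (2 * k + b + c + d + 1)) (N + a) x (x - 1) * (1 - x) ^ k
        * jacobiForm k (k + c) (k + b) (y / (1 - x)) (y / (1 - x) - 1) := by
  rw [koornP, if_neg (by omega), add_sub_cancel_left, jacobiP_natCast, jacobiP_natCast]
  simp only [Int.toNat_natCast, Int.cast_natCast]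
  congr 2 <;> ring_nf

theorem koorn_ladder_M20_M30 (a b c d : ℝ) (n k : ℤ) (hk : 0 ≤ k) (hnk : k ≤ n)
    (x y : ℝ) (hx : x ≠ 1) :
    (((n : ℝ) + (k : ℝ) + (a + b + c + d) + 2 + x * (k : ℝ) / (1 - x))
          * koornP n k a b c d x y
        + x * deriv (fun x' => koornP n k a b c d x' y) x
        - (x * y / (1 - x)) * deriv (koornP n k a b c d x) y
      = ((n : ℝ) + (k : ℝ) + (a + b + c + d) + 2) * koornP n k a b c (d + 1) x y) ∧
    (((n : ℝ) + (k : ℝ) + b + c + d + 1 - x * (n : ℝ)) * koornP n k a b c d x y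
        - x * (1 - x) * deriv (fun x' => koornP n k a b c d x' y) x
        + x * y * deriv (koornP n k a b c d x) y
      = ((n : ℝ) + (k : ℝ) + (a + b + c + d) - a + 1) * koornP n k a b c (d - 1) x y) ∧
    (((n : ℝ) + a + b + c + d + 2) * koornP n k a b c d x y
        - (1 - x) * deriv (fun x' => koornP n k a b c d x' y) x
        + y * deriv (koornP n k a b c d x) y
      = ((n : ℝ) + (k : ℝ) + (a + b + c + d) + 2) * koornP n k (a + 1) b c d x y) ∧
    ((a + x * (n : ℝ)) * koornP n k a b c d x y
        + x * (1 - x) * deriv (fun x' => koornP n k a b c d x' y) x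
        - x * y * deriv (koornP n k a b c d x) y
      = ((n : ℝ) - (k : ℝ) + a) * koornP n k (a - 1) b c d x y) := by
  obtain ⟨k, rfl⟩ := Int.eq_ofNat_of_zero_le hk
  obtain ⟨N, rfl⟩ := Int.le.dest hnk
  have hx1 : 1 - x ≠ 0 := sub_ne_zero.2 hx.symm
  set p : ℝ := N + (2 * k + b + c + d + 1) with hp
  set q : ℝ := N + a with hq
  have hsub : HasDerivAt (fun t : ℝ => 1 - t) (-1) x := by
    simpa using (hasDerivAt_id x).const_sub 1
  have hF := HasDerivAt.jacobiForm N p q (hasDerivAt_id' x) ((hasDerivAt_id' x).sub_const 1)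
  have hpow : HasDerivAt (fun t : ℝ => (1 - t) ^ k) (-(k * (1 - x) ^ k / (1 - x))) x := by
    refine (hsub.fun_pow k).congr_deriv ?_
    cases k with
    | zero => simp
    | succ m => rw [Nat.add_sub_cancel]; field_simp; ring
  have hz : HasDerivAt (fun t : ℝ => y / (1 - t)) (y / (1 - x) ^ 2) x := by
    refine ((hasDerivAt_const x y).fun_div hsub hx1).congr_deriv ?_
    ring
  have hw : HasDerivAt (fun t : ℝ => t / (1 - x)) (1 / (1 - x)) y :=
    (hasDerivAt_id' y).div_const _
  have hux := ((hF.mul hpow).mul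
    (HasDerivAt.jacobiForm k (k + c) (k + b) hz (hz.sub_const 1))).deriv
  have huy := ((HasDerivAt.jacobiForm k (k + c) (k + b) hw (hw.sub_const 1)).const_mul
    (jacobiForm N p q x (x - 1) * (1 - x) ^ k)).deriv
  have hfx : (fun x' => koornP ((k : ℤ) + N) k a b c d x' y) = _ :=
    funext fun x' => koornP_add_natCast N k a b c d x' y
  have hfy : koornP ((k : ℤ) + N) k a b c d x = _ :=
    funext fun y' => koornP_add_natCast N k a b c d x y'
  have ha1 := koornP_add_natCast N k (a + 1) b c d x y
  have ha2 := koornP_add_natCast N k (a - 1) b c d x y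
  have hd1 := koornP_add_natCast N k a b c (d + 1) x y
  have hd2 := koornP_add_natCast N k a b c (d - 1) x y
  rw [show (N : ℝ) + (2 * k + b + c + (d + 1) + 1) = p + 1 by rw [hp]; ring] at hd1
  rw [show (N : ℝ) + (2 * k + b + c + (d - 1) + 1) = p - 1 by rw [hp]; ring] at hd2
  rw [show (N : ℝ) + (a + 1) = q + 1 by rw [hq]; ring] at ha1
  rw [show (N : ℝ) + (a - 1) = q - 1 by rw [hq]; ring] at ha2
  have hr1 := jacobiForm_raise N p q x (x - 1)
  have hr2 := jacobiForm_raise N q p (x - 1) x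
  have hl1 := jacobiForm_lower N p q x (x - 1)
  have hl2 := jacobiForm_lower N q p (x - 1) x
  have he := jacobiFormDeriv_euler N p q x (x - 1)
  simp only [jacobiForm_swap N _ _ (x - 1) x] at hr2 hl2
  simp only [Pi.mul_def] at hux
  rw [hfx, hfy, hux, huy, ha1, ha2, hd1, hd2]
  beta_reduce
  rw [← hp, ← hq]
  set J := jacobiForm N p q x (x - 1)
  set D := jacobiFormDeriv N p q x (x - 1)
  set E := jacobiFormDeriv N q p (x - 1) x
  set G := jacobiForm k (k + c) (k + b) (y / (1 - x)) (y / (1 - x) - 1)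
  set G₁ := jacobiFormDeriv k (k + c) (k + b) (y / (1 - x)) (y / (1 - x) - 1)
  set G₂ := jacobiFormDeriv k (k + b) (k + c) (y / (1 - x) - 1) (y / (1 - x))
  push_cast
  refine ⟨?_, ?_, ?_, ?_⟩
  · have hS : (k : ℝ) + N + k + (a + b + c + d) + 2 = p + q - N + 1 := by rw [hp, hq]; ring
    rw [hS]
    transitivity (1 - x) ^ k * G * ((p + q - N + 1) * J + x * (D + E))
    · field_simp
      ring
    · rw [hr1]; ring
  · have hS : (k : ℝ) + N + k + (a + b + c + d) - a + 1 = p := by rw [hp]; ring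
    have hS' : (k : ℝ) + N + k + b + c + d + 1 = p := by rw [hp]; ring
    rw [hS, hS']
    transitivity (1 - x) ^ k * G * (p * J - x * (N * J) - x * (1 - x) * (D + E))
    · field_simp
      ring
    · linear_combination (1 - x) ^ k * G * (hl1 + x * he)
  · have hS : (k : ℝ) + N + k + (a + b + c + d) + 2 = q + p - N + 1 := by rw [hp, hq]; ring
    have hS' : (k : ℝ) + N + a + b + c + d + 2 = q + p - N + 1 - k := by rw [hp, hq]; ring
    rw [hS, hS']
    transitivity (1 - x) ^ k * G * ((q + p - N + 1) * J - (1 - x) * (D + E))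
    · field_simp
      ring
    · linear_combination (1 - x) ^ k * G * hr2
  · have hS : (k : ℝ) + N - k + a = q := by rw [hq]; ring
    have hS' : a = q - N := by rw [hq]; ring
    rw [hS, hS']
    transitivity (1 - x) ^ k * G * ((q - N + x * N) * J + x * (1 - x) * (D + E))
    · field_simp
      ring
    · linear_combination (1 - x) ^ k * G * (hl2 + (1 - x) * he)
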